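/- Let n ≥ 3 be an odd integer. Among the subsets of Dic_{4n} of the form C = {a^i, a^j b, a^k b} with 0 ≤ i ≤ 2n−1 and 0 ≤ j < k ≤ 2n−1 (i.e., three-element subsets containing exactly one element of the cyclic subgroup generated by a): the number of MSTD such subsets is 2n(n−1)(2n−5), the number of MDTS such subsets is 4n(n−1), and the number of balanced such subsets is 2n(4n−3). -/

import Mathlib

open Finset Pointwise

/-- A finset of a group is MSTD if its sumset `A * A` is larger than its
difference set `A / A = {a₁ * a₂⁻¹}`. -/
def IsMSTD {G : Type*} [Group G] [DecidableEq G] (A : Finset G) : Prop :=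
  (A / A).card < (A * A).card

/-- A finset of a group is MDTS if its sumset is smaller than its difference set. -/
def IsMDTS {G : Type*} [Group G] [DecidableEq G] (A : Finset G) : Prop :=
  (A * A).card < (A / A).card

/-- A finset of a group is balanced if its sumset and difference set have equal size. -/
def IsBalanced {G : Type*} [Group G] [DecidableEq G] (A : Finset G) : Prop :=
  (A * A).card = (A / A).card

/-- Subsets of the form `{a^i, a^j b, a^k b}` with `0 ≤ i ≤ 2n-1` and `0 ≤ j < k ≤ 2n-1`. -/
def IsTypeC (n : ℕ) (A : Finset (QuaternionGroup n)) : Prop :=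
  ∃ i j k : ℕ, i ≤ 2 * n - 1 ∧ j < k ∧ k ≤ 2 * n - 1 ∧
    A = {QuaternionGroup.a (i : ZMod (2 * n)), QuaternionGroup.xa (j : ZMod (2 * n)),
         QuaternionGroup.xa (k : ZMod (2 * n))}

open QuaternionGroup

section Dicyclic

variable {n : ℕ}

/-- The subset `{a x, xa u, xa v}` of the dicyclic group. -/
def typeCSet (x u v : ZMod (2 * n)) : Finset (QuaternionGroup n) := {a x, xa u, xa v}

theorem natCast_add_self_zmod : (n : ZMod (2 * n)) + n = 0 := by
  have h := ZMod.natCast_self (2 * n)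
  push_cast at h
  linear_combination h

theorem add_self_ne_natCast (hodd : Odd n) (x : ZMod (2 * n)) : x + x ≠ n := by
  intro h
  have h2 := congrArg (ZMod.castHom (Dvd.intro n rfl : 2 ∣ 2 * n) (ZMod 2)) h
  rw [map_add, map_natCast, CharTwo.add_self_eq_zero,
    ZMod.natCast_eq_one_iff_odd.mpr hodd] at h2
  exact zero_ne_one h2

theorem add_self_eq_zero_iff_zmod [NeZero n] (x : ZMod (2 * n)) :
    x + x = 0 ↔ x = 0 ∨ x = n := by
  constructor
  · intro h
    rcases (ZMod.neg_eq_self_iff x).mp (by linear_combination -h) with h0 | h0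
    · exact Or.inl h0
    · right
      rw [← ZMod.natCast_zmod_val x, Nat.eq_of_mul_eq_mul_left two_pos h0]
  · rintro (rfl | rfl)
    · simp
    · exact natCast_add_self_zmod

theorem card_image_a_union_image_xa (s t : Finset (ZMod (2 * n))) :
    (s.image a ∪ t.image xa).card = s.card + t.card := by
  rw [card_union_of_disjoint, card_image_of_injective, card_image_of_injective]
  · intro x y h; simpa using h
  · intro x y h; simpa using h
  · rw [disjoint_left]; simp

theorem card_typeCSet_mul (x u v : ZMod (2 * n)) :
    (typeCSet x u v * typeCSet x u v).card =
      ({x + x, (n : ZMod (2 * n)), n + v - u, n + u - v} : Finset (ZMod (2 * n))).card +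
      ({u - x, v - x, u + x, v + x} : Finset (ZMod (2 * n))).card := by
  rw [← card_image_a_union_image_xa]
  congr 1
  ext g
  rcases g with g | g <;> simp [typeCSet, mem_mul] <;> grind

theorem inv_xa_eq (u : ZMod (2 * n)) : (xa u : QuaternionGroup n)⁻¹ = xa ((n : ZMod (2 * n)) + u) := rfl

theorem inv_a_eq (u : ZMod (2 * n)) : (a u : QuaternionGroup n)⁻¹ = a (-u) := rfl

theorem card_typeCSet_div (x u v : ZMod (2 * n)) :
    (typeCSet x u v / typeCSet x u v).card =
      ({0, v - u, u - v} : Finset (ZMod (2 * n))).card +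
      ({u - x, v - x, u - x + n, v - x + n} : Finset (ZMod (2 * n))).card := by
  rw [← card_image_a_union_image_xa]
  congr 1
  have h := natCast_add_self_zmod (n := n)
  ext g
  rcases g with g | g <;>
    simp [typeCSet, mem_mul, div_eq_mul_inv, inv_xa_eq, inv_a_eq, -a_zero] <;> grind

theorem card_typeCSet_div_of_eq (hodd : Odd n) {x u v : ZMod (2 * n)} (h : v - u = n) :
    (typeCSet x u v / typeCSet x u v).card = 4 := by
  have h0 := natCast_add_self_zmod (n := n)
  have h1 := add_self_ne_natCast hodd 0
  rw [card_typeCSet_div]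
  simp only [card_insert_eq_ite, mem_insert, mem_singleton, card_singleton]
  grind

theorem card_typeCSet_div_of_ne [NeZero n] (hodd : Odd n) {x u v : ZMod (2 * n)} (huv : u ≠ v)
    (h : v - u ≠ n) : (typeCSet x u v / typeCSet x u v).card = 7 := by
  have h0 := natCast_add_self_zmod (n := n)
  have h1 := add_self_ne_natCast hodd 0
  have h2 := add_self_eq_zero_iff_zmod (v - u)
  rw [card_typeCSet_div]
  simp only [card_insert_eq_ite, mem_insert, mem_singleton, card_singleton]
  grind

theorem isTypeC_iff [NeZero n] (A : Finset (QuaternionGroup n)) :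
    IsTypeC n A ↔ ∃ x u v : ZMod (2 * n), u ≠ v ∧ A = typeCSet x u v := by
  have hpos : 0 < 2 * n := Nat.pos_of_neZero _
  constructor
  · rintro ⟨i, j, k, -, hjk, hk, rfl⟩
    refine ⟨i, j, k, fun h => hjk.ne ?_, rfl⟩
    have h' := congrArg ZMod.val h
    rwa [ZMod.val_natCast_of_lt (by omega), ZMod.val_natCast_of_lt (by omega)] at h'
  · rintro ⟨x, u, v, huv, rfl⟩
    have hx := ZMod.val_lt x
    have hu := ZMod.val_lt u
    have hv := ZMod.val_lt v
    rcases lt_or_gt_of_ne (fun h => huv (ZMod.val_injective _ h)) with h | h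
    · refine ⟨x.val, u.val, v.val, by omega, h, by omega, ?_⟩
      simp [typeCSet]
    · refine ⟨x.val, v.val, u.val, by omega, h, by omega, ?_⟩
      simp [typeCSet, pair_comm]

theorem typeCSet_eq_iff {x u v x' u' v' : ZMod (2 * n)} (h : u ≠ v) :
    typeCSet x' u' v' = typeCSet x u v ↔
      x' = x ∧ (u' = u ∧ v' = v ∨ u' = v ∧ v' = u) := by
  constructor
  · intro heq
    have key (g) : g ∈ typeCSet x' u' v' ↔ g ∈ typeCSet x u v := by rw [heq]
    have h1 := key (a x)
    have h2 := key (xa u)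
    have h3 := key (xa v)
    have h4 := key (xa u')
    have h5 := key (xa v')
    simp [typeCSet] at h1 h2 h3 h4 h5
    grind
  · rintro ⟨rfl, ⟨rfl, rfl⟩ | ⟨rfl, rfl⟩⟩
    · rfl
    · simp [typeCSet, pair_comm]

theorem ncard_isTypeC_and [NeZero n] (P : Finset (QuaternionGroup n) → Prop)
    (D : ZMod (2 * n) → Finset (ZMod (2 * n))) (hD : ∀ x, 0 ∉ D x)
    (hP : ∀ x u v, u ≠ v → (P (typeCSet x u v) ↔ v - u ∈ D x))
    (hsymm : ∀ x d, d ∈ D x → -d ∈ D x) :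
    {A | IsTypeC n A ∧ P A}.ncard = n * ∑ x, (D x).card := by
  let F : ZMod (2 * n) × ZMod (2 * n) × ZMod (2 * n) → Finset (QuaternionGroup n) :=
    fun p => typeCSet p.1 p.2.1 p.2.2
  let T : Finset (ZMod (2 * n) × ZMod (2 * n) × ZMod (2 * n)) :=
    univ.filter fun p => p.2.2 - p.2.1 ∈ D p.1
  have hne {p} (hp : p ∈ T) : p.2.1 ≠ p.2.2 := by
    intro h
    have := (mem_filter.mp hp).2
    rw [h, sub_self] at this
    exact hD _ this
  have hset : {A | IsTypeC n A ∧ P A} = (T.image F : Set (Finset (QuaternionGroup n))) := by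
    ext A
    simp only [Set.mem_ofPred_eq, isTypeC_iff, coe_image, Set.mem_image, mem_coe]
    constructor
    · rintro ⟨⟨x, u, v, huv, rfl⟩, h⟩
      exact ⟨(x, u, v), by simpa [T] using (hP x u v huv).mp h, rfl⟩
    · rintro ⟨p, hp, rfl⟩
      exact ⟨⟨p.1, p.2.1, p.2.2, hne hp, rfl⟩,
        (hP _ _ _ (hne hp)).mpr (mem_filter.mp hp).2⟩
  have hfib : T.card = (T.image F).card * 2 := by
    rw [card_eq_sum_card_image F T]
    refine sum_const_nat fun A hA => ?_
    obtain ⟨⟨x, u, v⟩, hp, rfl⟩ := mem_image.mp hA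
    have huv : u ≠ v := hne hp
    have hd : v - u ∈ D x := (mem_filter.mp hp).2
    have hd' : u - v ∈ D x := by simpa using hsymm x _ hd
    have : {q ∈ T | F q = F (x, u, v)} = {(x, u, v), (x, v, u)} := by
      ext ⟨x', u', v'⟩
      simp only [T, F, mem_filter, mem_univ, true_and, typeCSet_eq_iff huv, mem_insert,
        mem_singleton, Prod.mk.injEq]
      grind
    rw [this, card_pair]
    simp [huv]
  have hcard : T.card = 2 * n * ∑ x, (D x).card := by
    have hprod : ((univ : Finset (ZMod (2 * n))) ×ˢ univ.sigma D).card
        = 2 * n * ∑ x, (D x).card := by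
      rw [card_product, card_sigma, card_univ, ZMod.card]
    rw [← hprod]
    refine card_bij' (fun p _ => (p.2.1, ⟨p.1, p.2.2 - p.2.1⟩))
      (fun q _ => (q.2.1, q.1, q.1 + q.2.2)) ?_ ?_ ?_ ?_ <;> simp [T]
  rw [hset, Set.ncard_coe_finset]
  linarith

theorem sum_card_ite_add_self_eq_zero [NeZero n] {p q : ℕ} (s : Finset (ZMod (2 * n)))
    (t : ZMod (2 * n) → Finset (ZMod (2 * n))) (hs : s.card = p)
    (ht : ∀ x, x + x ≠ 0 → (t x).card = q) :
    ∑ x, (if x + x = 0 then s else t x).card = 2 * p + (2 * n - 2) * q := by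
  have h0 : (univ.filter fun x : ZMod (2 * n) => x + x = 0).card = 2 := by
    have : (univ.filter fun x : ZMod (2 * n) => x + x = 0) = {0, (n : ZMod (2 * n))} := by
      ext x
      simp [add_self_eq_zero_iff_zmod]
    rw [this, card_pair]
    intro h
    have h' := (ZMod.natCast_eq_zero_iff n (2 * n)).mp h.symm
    have := Nat.le_of_dvd (Nat.pos_of_neZero n) h'
    have := Nat.pos_of_neZero n
    omega
  have h1 := card_filter_add_card_filter_not (s := (univ : Finset (ZMod (2 * n))))
    (fun x => x + x = 0)
  rw [h0, card_univ, ZMod.card] at h1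
  rw [← sum_filter_add_sum_filter_not univ fun x : ZMod (2 * n) => x + x = 0,
    sum_const_nat (m := p) (by simp +contextual [hs]),
    sum_const_nat (m := q) (by simp +contextual [ht]), h0]
  congr 2
  omega

theorem card_typeCSet_mul_of_eq (hodd : Odd n) {x u v : ZMod (2 * n)} (h : v - u = n) :
    (typeCSet x u v * typeCSet x u v).card = if x + x = 0 then 4 else 7 := by
  have h0 := natCast_add_self_zmod (n := n)
  have h1 := add_self_ne_natCast hodd 0
  have h2 := add_self_ne_natCast hodd x
  rw [card_typeCSet_mul]
  simp only [card_insert_eq_ite, mem_insert, mem_singleton, card_singleton]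
  grind

/-- The elements `±2x` and `±2x + n` of `ZMod (2 * n)`. -/
def exceptionalDiffs (x : ZMod (2 * n)) : Finset (ZMod (2 * n)) :=
  {x + x, -(x + x), x + x + n, -(x + x) + n}

theorem card_typeCSet_mul_of_ne [NeZero n] (hodd : Odd n) {x u v : ZMod (2 * n)} (huv : u ≠ v)
    (h : v - u ≠ n) : (typeCSet x u v * typeCSet x u v).card =
      if x + x = 0 then 6 else if v - u ∈ exceptionalDiffs x then 7 else 8 := by
  have h0 := natCast_add_self_zmod (n := n)
  have h1 := add_self_ne_natCast hodd 0
  have h2 := add_self_ne_natCast hodd x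
  have h3 := add_self_eq_zero_iff_zmod (v - u)
  have h4 := add_self_eq_zero_iff_zmod (x + x)
  have h5 := add_self_ne_natCast hodd (x + x)
  rw [card_typeCSet_mul]
  simp only [exceptionalDiffs, card_insert_eq_ite, mem_insert, mem_singleton, card_singleton]
  grind (splits := 20)

theorem card_exceptionalDiffs [NeZero n] (hodd : Odd n) {x : ZMod (2 * n)} (hx : x + x ≠ 0) :
    (exceptionalDiffs x).card = 4 := by
  have h0 := natCast_add_self_zmod (n := n)
  have h1 := add_self_ne_natCast hodd 0
  have h2 := add_self_ne_natCast hodd x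
  have h4 := add_self_eq_zero_iff_zmod (x + x)
  have h5 := add_self_ne_natCast hodd (x + x)
  simp only [exceptionalDiffs, card_insert_eq_ite, mem_insert, mem_singleton, card_singleton]
  grind

theorem zero_notMem_exceptionalDiffs (hodd : Odd n) {x : ZMod (2 * n)} (hx : x + x ≠ 0) :
    0 ∉ exceptionalDiffs x := by
  have h0 := natCast_add_self_zmod (n := n)
  have h2 := add_self_ne_natCast hodd x
  simp only [exceptionalDiffs, mem_insert, mem_singleton]
  grind

theorem natCast_notMem_exceptionalDiffs (hodd : Odd n) {x : ZMod (2 * n)} (hx : x + x ≠ 0) :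
    (n : ZMod (2 * n)) ∉ exceptionalDiffs x := by
  have h0 := natCast_add_self_zmod (n := n)
  have h2 := add_self_ne_natCast hodd x
  simp only [exceptionalDiffs, mem_insert, mem_singleton]
  grind

theorem neg_mem_exceptionalDiffs {x d : ZMod (2 * n)} (hd : d ∈ exceptionalDiffs x) :
    -d ∈ exceptionalDiffs x := by
  have h0 := natCast_add_self_zmod (n := n)
  simp only [exceptionalDiffs, mem_insert, mem_singleton] at hd ⊢
  grind

theorem neg_natCast_zmod : -(n : ZMod (2 * n)) = n :=
  neg_eq_of_add_eq_zero_left natCast_add_self_zmod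

theorem ncard_isTypeC_and_isMSTD [NeZero n] (hodd : Odd n) :
    {A : Finset (QuaternionGroup n) | IsTypeC n A ∧ IsMSTD A}.ncard
      = n * ((2 * n - 2) * (2 * n - 5)) := by
  have key := sum_card_ite_add_self_eq_zero (n := n) (p := 0) (q := 2 * n - 5) ∅
    (fun x => (insert 0 (exceptionalDiffs x))ᶜ) rfl fun x hx => by
      rw [card_compl, ZMod.card, card_insert_of_notMem (zero_notMem_exceptionalDiffs hodd hx),
        card_exceptionalDiffs hodd hx]
  rw [ncard_isTypeC_and IsMSTD _ _ _ _, key, mul_zero, zero_add]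
  · intro x
    split_ifs <;> simp
  · intro x u v huv
    have hn := natCast_notMem_exceptionalDiffs hodd (x := x)
    have huv' : v - u ≠ 0 := sub_ne_zero.mpr huv.symm
    unfold IsMSTD
    by_cases h : v - u = n
    · rw [card_typeCSet_div_of_eq hodd h, card_typeCSet_mul_of_eq hodd h]
      split_ifs with hx
      · simp
      · simpa [← h, huv'] using h ▸ hn hx
    · rw [card_typeCSet_div_of_ne hodd huv h, card_typeCSet_mul_of_ne hodd huv h]
      split_ifs <;> simp_all
  · intro x d hd
    split_ifs at hd ⊢ with hx
    · simp at hd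
    · simp only [mem_compl, mem_insert, not_or, neg_eq_zero] at hd ⊢
      exact ⟨hd.1, fun h => hd.2 (by simpa using neg_mem_exceptionalDiffs h)⟩

theorem ncard_isTypeC_and_isMDTS [NeZero n] (hodd : Odd n) :
    {A : Finset (QuaternionGroup n) | IsTypeC n A ∧ IsMDTS A}.ncard
      = n * (2 * (2 * n - 2)) := by
  have hn0 : (0 : ZMod (2 * n)) ≠ n := by simpa using add_self_ne_natCast hodd 0
  have key := sum_card_ite_add_self_eq_zero (n := n) (p := 2 * n - 2) (q := 0)
    {0, (n : ZMod (2 * n))}ᶜ (fun _ => ∅) (by rw [card_compl, ZMod.card, card_pair hn0])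
    fun x hx => rfl
  rw [ncard_isTypeC_and IsMDTS _ _ _ _, key, mul_zero, add_zero]
  · intro x
    split_ifs <;> simp
  · intro x u v huv
    have huv' : v - u ≠ 0 := sub_ne_zero.mpr huv.symm
    unfold IsMDTS
    by_cases h : v - u = n
    · rw [card_typeCSet_div_of_eq hodd h, card_typeCSet_mul_of_eq hodd h]
      split_ifs <;> simp [h]
    · rw [card_typeCSet_div_of_ne hodd huv h, card_typeCSet_mul_of_ne hodd huv h]
      split_ifs <;> simp [h, huv']
  · intro x d hd
    split_ifs at hd ⊢ with hx
    · simpa [neg_eq_iff_eq_neg, neg_natCast_zmod] using hd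
    · simp at hd

theorem ncard_isTypeC_and_isBalanced [NeZero n] (hodd : Odd n) :
    {A : Finset (QuaternionGroup n) | IsTypeC n A ∧ IsBalanced A}.ncard
      = n * (2 + (2 * n - 2) * 4) := by
  have hn0 : (0 : ZMod (2 * n)) ≠ n := by simpa using add_self_ne_natCast hodd 0
  have key := sum_card_ite_add_self_eq_zero (n := n) {(n : ZMod (2 * n))} exceptionalDiffs
    (card_singleton _) fun x hx => card_exceptionalDiffs hodd hx
  rw [ncard_isTypeC_and IsBalanced _ _ _ _, key, mul_one]
  · intro x
    split_ifs with hx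
    · simpa using hn0
    · exact zero_notMem_exceptionalDiffs hodd hx
  · intro x u v huv
    have hn := natCast_notMem_exceptionalDiffs hodd (x := x)
    unfold IsBalanced
    by_cases h : v - u = n
    · rw [card_typeCSet_div_of_eq hodd h, card_typeCSet_mul_of_eq hodd h]
      split_ifs with hx
      · simp [h]
      · simpa [h] using hn hx
    · rw [card_typeCSet_div_of_ne hodd huv h, card_typeCSet_mul_of_ne hodd huv h]
      split_ifs <;> simp_all
  · intro x d hd
    split_ifs at hd ⊢ with hx
    · simpa [neg_eq_iff_eq_neg, neg_natCast_zmod] using hd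
    · exact neg_mem_exceptionalDiffs hd

end Dicyclic

theorem stmt_14 (n : ℕ) (hn : 3 ≤ n) (hodd : Odd n) :
    {A : Finset (QuaternionGroup n) | IsTypeC n A ∧ IsMSTD A}.ncard
        = 2 * n * (n - 1) * (2 * n - 5) ∧
    {A : Finset (QuaternionGroup n) | IsTypeC n A ∧ IsMDTS A}.ncard = 4 * n * (n - 1) ∧
    {A : Finset (QuaternionGroup n) | IsTypeC n A ∧ IsBalanced A}.ncard
        = 2 * n * (4 * n - 3) := by
  have : NeZero n := ⟨by omega⟩
  rw [ncard_isTypeC_and_isMSTD hodd, ncard_isTypeC_and_isMDTS hodd,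
    ncard_isTypeC_and_isBalanced hodd]
  obtain ⟨m, rfl⟩ : ∃ m, n = m + 3 := ⟨n - 3, by omega⟩
  rw [show 2 * (m + 3) - 2 = 2 * (m + 2) by omega, show m + 3 - 1 = m + 2 by omega,
    show 4 * (m + 3) - 3 = 4 * m + 9 by omega]
  refine ⟨?_, ?_, ?_⟩ <;> ring
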